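/- arXiv:2205.10754 — 2 statements merged into one kernel-verified Lean document; each statement's English description precedes it below -/
import Mathlib

section
/- Let K be an imaginary quadratic field and O an order in K. For every positive integer ℓ, I(O, ℓ) ∩ M(O) = M(O, ℓ); that is, an invertible fractional O-ideal which lies in the subgroup of I(O) generated by the nonzero proper O-ideals prime to ℓ and which is itself a nonzero proper integral O-ideal must be prime to ℓ, and conversely every element of M(O, ℓ) lies in I(O, ℓ) ∩ M(O). -/
open scoped nonZeroDivisors

set_option synthInstance.maxHeartbeats 1000000
set_option maxHeartbeats 1000000

noncomputable section

variable (K : Type) [Field K] [NumberField K]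

/-- The fractional `O`-ideals of `K` (for `O` a subring of `K`). -/
abbrev Frac (O : Subalgebra ℤ K) := FractionalIdeal ((O : Type))⁰ K

/-- A nonzero ideal `a` of `O` is *prime to* `m` if `a + mO = O`. -/
def primeTo (O : Subalgebra ℤ K) (m : ℕ) (a : Ideal O) : Prop :=
  a ⊔ Ideal.span {(m : O)} = ⊤

/-- `M(O, m)`: the nonzero proper (equivalently, invertible) `O`-ideals prime to `m`. -/
def Mset (O : Subalgebra ℤ K) (m : ℕ) : Set (Ideal O) :=
  {a | a ≠ 0 ∧ primeTo K O m a ∧ IsUnit (a : Frac K O)}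

/-- `I(O, m)`: the subgroup of the group of invertible fractional `O`-ideals generated by
`M(O, m)`. -/
def Igrp (O : Subalgebra ℤ K) (m : ℕ) : Subgroup (Frac K O)ˣ :=
  Subgroup.closure {u | ∃ a ∈ Mset K O m, (u : Frac K O) = a}

/-- `O` is an order of the imaginary quadratic field `K`:  `K` has degree 2 over `ℚ`, has no
real embeddings, and `O` is a subring of `K` which is finitely generated as a ℤ-module and
contains a ℚ-basis of `K` (i.e. spans `K` over ℚ). -/
structure IsImagQuadOrder (O : Subalgebra ℤ K) : Prop where
  degree_two : Module.finrank ℚ K = 2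
  no_real_embedding : ∀ v : NumberField.InfinitePlace K, v.IsComplex
  fg : (Subalgebra.toSubmodule O).FG
  spans : Submodule.span ℚ (O : Set K) = ⊤

/-!
STATEMENT 8: `I(O, ℓ) ∩ M(O) = M(O, ℓ)`: a nonzero proper integral `O`-ideal whose associated
invertible fractional ideal lies in the subgroup `I(O, ℓ)` generated by the nonzero proper
`O`-ideals prime to `ℓ` must itself be prime to `ℓ`; and conversely every member of `M(O, ℓ)`
is a nonzero proper ideal whose fractional ideal lies in `I(O, ℓ)`.
-/

theorem le_of_coe_mul_aux {R P : Type} [CommRing R] [CommRing P] [Algebra R P]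
    (S : Submonoid R) (hinj : Function.Injective (algebraMap R P)) (a b c : Ideal R)
    (h : (a : FractionalIdeal S P) * (c : FractionalIdeal S P) = (b : FractionalIdeal S P)) :
    b ≤ a := by
  intro x hx
  rw [← FractionalIdeal.coeIdeal_mul] at h
  have h1 : algebraMap R P x ∈ (b : FractionalIdeal S P) :=
    (FractionalIdeal.mem_coeIdeal S).2 ⟨x, hx, rfl⟩
  rw [← h] at h1
  obtain ⟨z, hz, hzx⟩ := (FractionalIdeal.mem_coeIdeal S).1 h1
  have hle : a * c ≤ a := Ideal.mul_le_inf.trans inf_le_left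
  have hz' : z ∈ a := hle hz
  have e : z = x := hinj hzx
  rw [← e]
  exact hz'

theorem primeTo_mul_aux (O : Subalgebra ℤ K) (m : ℕ) {a b : Ideal O}
    (ha : primeTo K O m a) (hb : primeTo K O m b) : primeTo K O m (a * b) := by
  unfold primeTo at *
  rw [← Ideal.isCoprime_iff_sup_eq] at *
  exact IsCoprime.mul_left ha hb

theorem Igrp_quot_aux (O : Subalgebra ℤ K) (m : ℕ) (u : (Frac K O)ˣ) (hu : u ∈ Igrp K O m) :
    ∃ b c : Ideal O, primeTo K O m b ∧ primeTo K O m c ∧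
      (u : Frac K O) * (c : Frac K O) = (b : Frac K O) := by
  unfold Igrp at hu
  induction hu using Subgroup.closure_induction with
  | mem x hx =>
    obtain ⟨a, ha, h⟩ := hx
    refine ⟨a, ⊤, ha.2.1, ?_, ?_⟩
    · simp [primeTo]
    · rw [h, FractionalIdeal.coeIdeal_top, mul_one]
  | one =>
    refine ⟨⊤, ⊤, ?_, ?_, ?_⟩
    · simp [primeTo]
    · simp [primeTo]
    · rw [Units.val_one, one_mul]
  | mul x y _ _ hx hy =>
    obtain ⟨b, c, hb, hc, h⟩ := hx
    obtain ⟨b', c', hb', hc', h'⟩ := hy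
    refine ⟨b * b', c * c', primeTo_mul_aux K O m hb hb', primeTo_mul_aux K O m hc hc', ?_⟩
    rw [FractionalIdeal.coeIdeal_mul, FractionalIdeal.coeIdeal_mul, ← h, ← h', Units.val_mul,
      mul_mul_mul_comm]
  | inv x _ hx =>
    obtain ⟨b, c, hb, hc, h⟩ := hx
    exact ⟨c, b, hc, hb, by rw [← h, Units.inv_mul_cancel_left]⟩

theorem statement8 (K : Type) [Field K] [NumberField K]
    (O : Subalgebra ℤ K) (hO : IsImagQuadOrder K O) (ℓ : ℕ) (hℓ : 0 < ℓ) (a : Ideal O) :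
    (a ≠ 0 ∧ IsUnit (a : Frac K O) ∧
        ∃ u : (Frac K O)ˣ, (u : Frac K O) = (a : Frac K O) ∧ u ∈ Igrp K O ℓ) ↔
      a ∈ Mset K O ℓ := by
  constructor
  · rintro ⟨h0, hu, u, hua, hmem⟩
    refine ⟨h0, ?_, hu⟩
    obtain ⟨b, c, hb, -, h⟩ := Igrp_quot_aux K O ℓ u hmem
    rw [hua] at h
    have hle : b ≤ a := le_of_coe_mul_aux _ Subtype.val_injective a b c h
    unfold primeTo at *
    exact top_le_iff.1 (hb ▸ sup_le_sup_right hle _)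
  · intro ha
    refine ⟨ha.1, ha.2.2, ha.2.2.unit, rfl, ?_⟩
    exact Subgroup.subset_closure ⟨a, ha, rfl⟩
end
end

section
/- Let K be an imaginary quadratic field, O an order in K, and N a positive integer. Then P_N(O) coincides with the set { (ν₁/ν₂)O : ν₁, ν₂ ∈ O ∖ {0} such that the ideals ν₁O and ν₂O are prime to N and ν₁ ≡ ν₂ (mod NO) }. -/
open scoped nonZeroDivisors

set_option synthInstance.maxHeartbeats 1000000
set_option maxHeartbeats 1000000

noncomputable section

variable (K : Type) [Field K] [NumberField K]

/-- `P_N(O)`: the subgroup of invertible fractional `O`-ideals generated by the principal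
ideals `νO` with `ν ∈ O` nonzero and `ν ≡ 1 (mod NO)`. -/
def Pgrp (O : Subalgebra ℤ K) (N : ℕ) : Subgroup (Frac K O)ˣ :=
  Subgroup.closure {u | ∃ ν : (O : Type), ν ≠ 0 ∧ (∃ μ : (O : Type), ν = 1 + (N : (O : Type)) * μ) ∧
    (u : Frac K O) = ((Ideal.span {ν} : Ideal O) : Frac K O)}

theorem aux_isUnit (K : Type) [Field K] [NumberField K] (O : Subalgebra ℤ K) (ν : (O : Type))
    (h : ν ≠ 0) : IsUnit ((Ideal.span {ν} : Ideal O) : Frac K O) := by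
  have hx : (algebraMap (O : Type) K ν) ≠ 0 := by
    intro h0
    exact h (Subtype.ext h0)
  let J : Frac K O := ⟨Submodule.span (O : Type) {(algebraMap (O : Type) K ν)⁻¹}, ν,
    mem_nonZeroDivisors_of_ne_zero h, fun b hb => by
      obtain ⟨c, rfl⟩ := Submodule.mem_span_singleton.1 hb
      refine ⟨c, ?_⟩
      rw [Algebra.smul_def, Algebra.smul_def]
      field_simp⟩
  refine IsUnit.of_mul_eq_one J ?_
  apply FractionalIdeal.coeToSubmodule_injective
  beta_reduce
  rw [FractionalIdeal.coe_mul, FractionalIdeal.coe_coeIdeal,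
    IsLocalization.coeSubmodule_span_singleton, FractionalIdeal.coe_one]
  change _ * Submodule.span (O : Type) {(algebraMap (O : Type) K ν)⁻¹} = _
  rw [Submodule.span_mul_span, Set.singleton_mul_singleton, mul_inv_cancel₀ hx,
    Submodule.one_eq_span]

theorem aux_primeTo (K : Type) [Field K] [NumberField K] (O : Subalgebra ℤ K) (N : ℕ)
    (ν : (O : Type)) : primeTo K O N (Ideal.span {ν}) ↔
      ∃ a b : (O : Type), a * ν + b * (N : (O : Type)) = 1 := by
  unfold primeTo
  rw [← Ideal.span_union, Set.singleton_union, Ideal.eq_top_iff_one, Ideal.mem_span_pair]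

theorem aux_mul (K : Type) [Field K] [NumberField K] (O : Subalgebra ℤ K) (a b : (O : Type)) :
    ((Ideal.span {a * b} : Ideal O) : Frac K O) =
      ((Ideal.span {a} : Ideal O) : Frac K O) * ((Ideal.span {b} : Ideal O) : Frac K O) := by
  rw [← FractionalIdeal.coeIdeal_mul, Ideal.span_singleton_mul_span_singleton]

theorem aux_one (K : Type) [Field K] [NumberField K] (O : Subalgebra ℤ K) :
    ((Ideal.span {(1 : (O : Type))} : Ideal O) : Frac K O) = 1 := by
  rw [Ideal.span_singleton_one, FractionalIdeal.coeIdeal_top]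

/-!
STATEMENT 10: `P_N(O)` coincides with the set
`{(ν₁/ν₂)O : ν₁, ν₂ ∈ O ∖ {0}, ν₁O and ν₂O prime to N, ν₁ ≡ ν₂ (mod NO)}`.
Here `u = (ν₁/ν₂)O` is expressed by `u · (ν₂O) = ν₁O`.
-/

theorem statement10 (K : Type) [Field K] [NumberField K]
    (O : Subalgebra ℤ K) (hO : IsImagQuadOrder K O) (N : ℕ) (hN : 0 < N) :
    ((Pgrp K O N : Subgroup (Frac K O)ˣ) : Set (Frac K O)ˣ) =
      {u : (Frac K O)ˣ | ∃ ν₁ ν₂ : (O : Type), ν₁ ≠ 0 ∧ ν₂ ≠ 0 ∧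
        primeTo K O N (Ideal.span {ν₁}) ∧ primeTo K O N (Ideal.span {ν₂}) ∧
        (∃ μ : (O : Type), ν₁ = ν₂ + (N : (O : Type)) * μ) ∧
        (u : Frac K O) * ((Ideal.span {ν₂} : Ideal O) : Frac K O) =
          ((Ideal.span {ν₁} : Ideal O) : Frac K O)} := by
  ext u
  simp only [SetLike.mem_coe, Set.mem_setOf_eq]
  constructor
  · intro hu
    unfold Pgrp at hu
    induction hu using Subgroup.closure_induction with
    | mem x hx =>
      obtain ⟨ν, h0, ⟨μ, hμ⟩, hx⟩ := hx
      refine ⟨ν, 1, h0, one_ne_zero, ?_, ?_, ⟨μ, hμ⟩, ?_⟩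
      · rw [aux_primeTo]
        exact ⟨1, -μ, by rw [hμ]; ring⟩
      · rw [aux_primeTo]
        exact ⟨1, 0, by ring⟩
      · rw [aux_one, mul_one, hx]
    | one =>
      refine ⟨1, 1, one_ne_zero, one_ne_zero, ?_, ?_, ⟨0, by ring⟩, ?_⟩
      · rw [aux_primeTo]
        exact ⟨1, 0, by ring⟩
      · rw [aux_primeTo]
        exact ⟨1, 0, by ring⟩
      · rw [Units.val_one, one_mul]
    | mul x y _ _ ihx ihy =>
      obtain ⟨a, b, ha, hb, pa, pb, ⟨μ, hμ⟩, hx⟩ := ihx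
      obtain ⟨c, d, hc, hd, pc, pd, ⟨η, hη⟩, hy⟩ := ihy
      have key : ∀ s t : (O : Type), primeTo K O N (Ideal.span {s}) →
          primeTo K O N (Ideal.span {t}) → primeTo K O N (Ideal.span {s * t}) := by
        intro s t hs ht
        rw [aux_primeTo] at *
        obtain ⟨p, q, h1⟩ := hs
        obtain ⟨r, w, h2⟩ := ht
        refine ⟨p * r, p * s * w + q * (r * t) + q * w * N, ?_⟩
        linear_combination (r * t + w * N) * h1 + h2
      refine ⟨a * c, b * d, mul_ne_zero ha hc, mul_ne_zero hb hd, key _ _ pa pc, key _ _ pb pd,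
        ⟨b * η + μ * d + N * μ * η, by rw [hμ, hη]; ring⟩, ?_⟩
      rw [aux_mul, aux_mul, ← hx, ← hy, Units.val_mul]
      ring
    | inv x _ ih =>
      obtain ⟨a, b, ha, hb, pa, pb, ⟨μ, hμ⟩, hx⟩ := ih
      refine ⟨b, a, hb, ha, pb, pa, ⟨-μ, by rw [hμ]; ring⟩, ?_⟩
      rw [← hx, Units.inv_mul_cancel_left]
  · rintro ⟨a, b, ha, hb, pa, pb, ⟨μ, hμ⟩, hu⟩
    have hex : ∃ p q : (O : Type), p ≠ 0 ∧ p * b = 1 + (N : (O : Type)) * q := by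
      rw [aux_primeTo] at pb
      obtain ⟨p, q, h⟩ := pb
      by_cases hp : p = 0
      · refine ⟨1, q * (b - 1), one_ne_zero, ?_⟩
        subst hp
        linear_combination (-(b - 1)) * h
      · exact ⟨p, -q, hp, by linear_combination h⟩
    obtain ⟨p, q, hp, hpq⟩ := hex
    obtain ⟨U, hU⟩ := aux_isUnit K O (p * a) (mul_ne_zero hp ha)
    obtain ⟨V, hV⟩ := aux_isUnit K O (p * b) (mul_ne_zero hp hb)
    have hUm : U ∈ Pgrp K O N := Subgroup.subset_closure
      ⟨p * a, mul_ne_zero hp ha, ⟨q + p * μ, by rw [hμ]; linear_combination hpq⟩, hU⟩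
    have hVm : V ∈ Pgrp K O N := Subgroup.subset_closure
      ⟨p * b, mul_ne_zero hp hb, ⟨q, hpq⟩, hV⟩
    have huv : u * V = U := by
      apply Units.ext
      rw [Units.val_mul, hU, hV, aux_mul, aux_mul, ← hu]
      ring
    rw [eq_mul_inv_of_mul_eq huv]
    exact mul_mem hUm (inv_mem hVm)
end
end
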